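/- Let C be a tame CFset-category. Then for all objects a, b, the inverse zeta function satisfies ζ_C^{-1}(a,b) = δ(a,b) + ∑_{k=1}^∞ (-1)^k ∑_{f_1∼⋯∼f_k, f_i ≠ id, sf_1 = a, tf_k = b} q^{∑_i deg f_i}, where the outer sum converges in the Novikov ring A and the right-hand side defines a two-sided inverse of ζ_C in M_C(A). -/

import Mathlib

noncomputable section
open Classical

/-- A function `f : ℝ → ℚ` is left finite. -/
def LeftFinite (f : ℝ → ℚ) : Prop := ∀ L : ℝ, {x : ℝ | x ≤ L ∧ f x ≠ 0}.Finite

/-- Membership of the Novikov series ring `A = ℚ[[q^ℝ]]`. -/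
def IsNov (f : ℝ → ℚ) : Prop := LeftFinite f ∧ ∀ x < (0 : ℝ), f x = 0

/-- Convolution product in `A`. -/
def conv (f g : ℝ → ℚ) : ℝ → ℚ := fun ℓ => ∑ᶠ x : ℝ, f x * g (ℓ - x)

/-- The unit `1 = q^0` of `A`. -/
def delta : ℝ → ℚ := fun x => if x = 0 then 1 else 0

/-- A category enriched in (`ℝ≥0`-)filtered sets: hom sets carry degrees, identities have
degree `0`, and composition does not increase total degree. -/
structure FCat (C : Type) where
  Hom : C → C → Type
  deg : ∀ {a b : C}, Hom a b → ℝ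
  id : ∀ a : C, Hom a a
  comp : ∀ {a b c : C}, Hom a b → Hom b c → Hom a c
  id_comp : ∀ {a b : C} (f : Hom a b), comp (id a) f = f
  comp_id : ∀ {a b : C} (f : Hom a b), comp f (id b) = f
  assoc : ∀ {a b c d : C} (f : Hom a b) (g : Hom b c) (h : Hom c d),
    comp (comp f g) h = comp f (comp g h)
  deg_nonneg : ∀ {a b : C} (f : Hom a b), 0 ≤ deg f
  deg_id : ∀ a : C, deg (id a) = 0
  deg_comp : ∀ {a b c : C} (f : Hom a b) (g : Hom b c), deg (comp f g) ≤ deg f + deg g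

variable {C : Type}

/-- `f` is an identity morphism. -/
def FCat.IsIdHom (X : FCat C) {a b : C} (f : X.Hom a b) : Prop :=
  a = b ∧ HEq f (X.id a)

/-- The enrichment is in collectable filtered sets: each filtration level of each hom
filtered set is finite. -/
def FCat.Collectable (X : FCat C) : Prop :=
  ∀ (a b : C) (ℓ : ℝ), {f : X.Hom a b | X.deg f ≤ ℓ}.Finite

/-- `X` is of finite type: for every object `a` and level `ℓ` there are only finitely many
morphisms of degree `≤ ℓ` with source `a`, or with target `a`. -/
def FCat.FiniteType (X : FCat C) : Prop :=
  ∀ (a : C) (ℓ : ℝ),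
    {p : Σ b : C, X.Hom a b | X.deg p.2 ≤ ℓ}.Finite ∧
    {p : Σ b : C, X.Hom b a | X.deg p.2 ≤ ℓ}.Finite

/-- The zeta function `ζ_X(a,b) = #X(a,b) = ∑_{f ∈ X(a,b)} q^{deg f}`. -/
def zeta (X : FCat C) (a b : C) : ℝ → ℚ :=
  fun x => (Nat.card {f : X.Hom a b // X.deg f = x} : ℚ)

/-- A non-degenerate path in `X` from `a` to `b`: a composable sequence of `n ≥ 1`
non-identity morphisms. -/
structure NDPath (X : FCat C) (a b : C) where
  n : ℕ
  npos : 0 < n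
  obj : Fin (n + 1) → C
  hom : ∀ i : Fin n, X.Hom (obj i.castSucc) (obj i.succ)
  src : obj 0 = a
  tgt : obj (Fin.last n) = b
  nonid : ∀ i : Fin n, ¬ X.IsIdHom (hom i)

/-- The length of a non-degenerate path. -/
def NDPath.length {X : FCat C} {a b : C} (p : NDPath X a b) : ℝ :=
  ∑ i : Fin p.n, X.deg (p.hom i)

/-- `X` is quasi-tame: of finite type, and there are finitely many non-degenerate paths
from `a` to `b` of length `≤ ℓ`, for all `a`, `b`, `ℓ`. -/
def QuasiTame (X : FCat C) : Prop :=
  X.FiniteType ∧ ∀ (a b : C) (ℓ : ℝ), {p : NDPath X a b | p.length ≤ ℓ}.Finite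

/-- `X` is tame: of finite type, and for every `ℓ` there is `N_ℓ > 0` such that every
non-degenerate `N_ℓ`-path has length `> ℓ`. -/
def Tame (X : FCat C) : Prop :=
  X.FiniteType ∧ ∀ ℓ : ℝ, ∃ N : ℕ, 0 < N ∧
    ∀ (a b : C) (p : NDPath X a b), p.n = N → ℓ < p.length

/-- Membership of `M_C(A)`. -/
def MSmat (C : Type) (f : C → C → ℝ → ℚ) : Prop :=
  ∀ (ℓ : ℝ) (s : C),
    {t : C | ∃ x : ℝ, x < ℓ ∧ f s t x ≠ 0}.Finite ∧
    {t : C | ∃ x : ℝ, x < ℓ ∧ f t s x ≠ 0}.Finite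

/-- Matrix convolution product. -/
def matConv (C : Type) (f g : C → C → ℝ → ℚ) : C → C → ℝ → ℚ :=
  fun s t x => ∑ᶠ u : C, conv (f s u) (g u t) x

/-- The identity matrix. -/
def matId (C : Type) : C → C → ℝ → ℚ := fun s t x => if s = t ∧ x = 0 then 1 else 0

/-- Powers of a matrix. -/
def matPow (C : Type) (f : C → C → ℝ → ℚ) : ℕ → (C → C → ℝ → ℚ)
  | 0 => matId C
  | n + 1 => matConv C f (matPow C f n)

/-- The number of non-degenerate `k`-paths from `a` to `b` of length `x`. -/
def pathCount (X : FCat C) (a b : C) (k : ℕ) (x : ℝ) : ℕ :=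
  Nat.card {p : NDPath X a b // p.n = k ∧ p.length = x}

theorem generic_conv {H : C → Type} (d : ∀ {u : C}, H u → ℝ) (x : ℝ)
    (S : Finset (Σ u : C, H u)) (hS : ∀ p, p ∈ S ↔ d p.2 ≤ x)
    (g : C → ℝ → ℚ) (hg : ∀ u y, y < 0 → g u y = 0) :
    (∑ᶠ u : C, ∑ᶠ y : ℝ, (Nat.card {f : H u // d f = y} : ℚ) * g u (x - y)) =
      ∑ p ∈ S, g p.1 (x - d p.2) := by
  have key : ∀ u y, (Nat.card {f : H u // d f = y} : ℚ) * g u (x - y) =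
      ∑ p ∈ S, if p.1 = u ∧ d p.2 = y then g u (x - y) else 0 := by
    intro u y
    by_cases hy : y ≤ x
    · rw [← Finset.sum_filter, Finset.sum_const, nsmul_eq_mul]
      congr 2
      rw [← Nat.card_eq_finsetCard]
      refine Nat.card_congr (Equiv.ofBijective
        (fun f => ⟨⟨u, f.1⟩, by
          rw [Finset.mem_filter, hS]
          exact ⟨by rw [f.2]; exact hy, rfl, f.2⟩⟩) ⟨?_, ?_⟩)
      · rintro ⟨f, hf⟩ ⟨f', hf'⟩ h
        simpa using h
      · rintro ⟨⟨u', f⟩, hf⟩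
        rw [Finset.mem_filter] at hf
        obtain ⟨_, h1, h2⟩ := hf
        dsimp only at h1 h2
        subst h1
        exact ⟨⟨f, h2⟩, rfl⟩
    · rw [hg u _ (by linarith)]
      simp
  simp_rw [key]
  have inner : ∀ u, (∑ᶠ y : ℝ, ∑ p ∈ S, if p.1 = u ∧ d p.2 = y then g u (x - y) else 0) =
      ∑ p ∈ S, if p.1 = u then g u (x - d p.2) else 0 := by
    intro u
    rw [finsum_eq_sum_of_support_subset (s := S.image fun p => d p.2), Finset.sum_comm]
    · refine Finset.sum_congr rfl fun p hp => ?_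
      by_cases h : p.1 = u
      · simp only [h, true_and, if_true]
        rw [Finset.sum_ite_eq, if_pos]
        exact Finset.mem_image_of_mem (fun p : (Σ u : C, H u) => d p.2) hp
      · simp [h]
    · intro y hy
      obtain ⟨p, hp, h⟩ := Finset.exists_ne_zero_of_sum_ne_zero hy
      have : p.1 = u ∧ d p.2 = y := by
        by_contra h'
        exact h (if_neg h')
      rw [Finset.mem_coe, Finset.mem_image]
      exact ⟨p, hp, this.2⟩
  simp_rw [inner]
  rw [finsum_eq_sum_of_support_subset (s := S.image fun p => p.1), Finset.sum_comm]
  · refine Finset.sum_congr rfl fun p hp => ?_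
    rw [Finset.sum_ite_eq, if_pos]
    exact Finset.mem_image_of_mem (fun p : (Σ u : C, H u) => p.1) hp
  · intro y hy
    obtain ⟨p, hp, h⟩ := Finset.exists_ne_zero_of_sum_ne_zero hy
    have : p.1 = y := by
      by_contra h'
      exact h (if_neg h')
    rw [Finset.mem_coe, Finset.mem_image]
    exact ⟨p, hp, this⟩

/-- morphisms out of `s` of degree at most `x` -/
def outS (X : FCat C) (hF : X.FiniteType) (s : C) (x : ℝ) : Finset (Σ b : C, X.Hom s b) :=
  (hF s x).1.toFinset

/-- morphisms into `t` of degree at most `x` -/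
def inS (X : FCat C) (hF : X.FiniteType) (t : C) (x : ℝ) : Finset (Σ b : C, X.Hom b t) :=
  (hF t x).2.toFinset

theorem mem_outS (X : FCat C) (hF : X.FiniteType) (s : C) (x : ℝ) (p : Σ b : C, X.Hom s b) :
    p ∈ outS X hF s x ↔ X.deg p.2 ≤ x := by simp [outS]

theorem mem_inS (X : FCat C) (hF : X.FiniteType) (s : C) (x : ℝ) (p : Σ b : C, X.Hom b s) :
    p ∈ inS X hF s x ↔ X.deg p.2 ≤ x := by simp [inS]

/-- non-identity morphisms out of `s` -/
def outN (X : FCat C) (hF : X.FiniteType) (s : C) (x : ℝ) : Finset (Σ b : C, X.Hom s b) :=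
  (outS X hF s x).erase ⟨s, X.id s⟩

/-- non-identity morphisms into `t` -/
def inN (X : FCat C) (hF : X.FiniteType) (t : C) (x : ℝ) : Finset (Σ b : C, X.Hom b t) :=
  (inS X hF t x).erase ⟨t, X.id t⟩

theorem mem_outN (X : FCat C) (hF : X.FiniteType) (s : C) (x : ℝ) (p : Σ b : C, X.Hom s b) :
    p ∈ outN X hF s x ↔ ¬ X.IsIdHom p.2 ∧ X.deg p.2 ≤ x := by
  rw [outN, Finset.mem_erase, mem_outS]
  refine and_congr_left fun _ => not_congr ?_
  obtain ⟨b, f⟩ := p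
  constructor
  · intro h
    cases h
    exact ⟨rfl, HEq.rfl⟩
  · rintro ⟨h1, h2⟩
    dsimp only at h1 h2
    subst h1
    rw [eq_of_heq h2]

theorem mem_inN (X : FCat C) (hF : X.FiniteType) (s : C) (x : ℝ) (p : Σ b : C, X.Hom b s) :
    p ∈ inN X hF s x ↔ ¬ X.IsIdHom p.2 ∧ X.deg p.2 ≤ x := by
  rw [inN, Finset.mem_erase, mem_inS]
  refine and_congr_left fun _ => not_congr ?_
  obtain ⟨b, f⟩ := p
  constructor
  · intro h
    cases h
    exact ⟨rfl, HEq.rfl⟩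
  · rintro ⟨h1, h2⟩
    dsimp only at h1 h2
    subst h1
    rw [eq_of_heq h2]

theorem sum_outS (X : FCat C) (hF : X.FiniteType) (s : C) (x : ℝ)
    (g : C → ℝ → ℚ) (hg : ∀ u y, y < 0 → g u y = 0) :
    ∑ p ∈ outS X hF s x, g p.1 (x - X.deg p.2) =
      g s x + ∑ p ∈ outN X hF s x, g p.1 (x - X.deg p.2) := by
  by_cases hx : 0 ≤ x
  · rw [outN, ← Finset.add_sum_erase (outS X hF s x) _ (a := ⟨s, X.id s⟩)]
    · simp [X.deg_id]
    · rw [mem_outS]; simpa [X.deg_id] using hx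
  · push Not at hx
    rw [hg s x hx, zero_add, outN, Finset.erase_eq_of_notMem]
    rw [mem_outS]; simpa [X.deg_id] using hx

theorem sum_inS (X : FCat C) (hF : X.FiniteType) (s : C) (x : ℝ)
    (g : C → ℝ → ℚ) (hg : ∀ u y, y < 0 → g u y = 0) :
    ∑ p ∈ inS X hF s x, g p.1 (x - X.deg p.2) =
      g s x + ∑ p ∈ inN X hF s x, g p.1 (x - X.deg p.2) := by
  by_cases hx : 0 ≤ x
  · rw [inN, ← Finset.add_sum_erase (inS X hF s x) _ (a := ⟨s, X.id s⟩)]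
    · simp [X.deg_id]
    · rw [mem_inS]; simpa [X.deg_id] using hx
  · push Not at hx
    rw [hg s x hx, zero_add, inN, Finset.erase_eq_of_notMem]
    rw [mem_inS]; simpa [X.deg_id] using hx

/-- recursive path counts -/
def Qc (X : FCat C) (hF : X.FiniteType) : ℕ → C → C → ℝ → ℚ
  | 0 => matId C
  | k + 1 => fun s t x => ∑ p ∈ outN X hF s x, Qc X hF k p.1 t (x - X.deg p.2)

theorem Qc_neg (X : FCat C) (hF : X.FiniteType) (k : ℕ) (s t : C) (x : ℝ) (hx : x < 0) :
    Qc X hF k s t x = 0 := by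
  cases k with
  | zero =>
    show (if s = t ∧ x = 0 then (1:ℚ) else 0) = 0
    rw [if_neg]; rintro ⟨_, h⟩; linarith
  | succ k =>
    refine Finset.sum_eq_zero fun p hp => ?_
    have := ((mem_outN ..).1 hp).2
    have := X.deg_nonneg p.2
    linarith

theorem sum_outN_ext (X : FCat C) (hF : X.FiniteType) (s : C) (x x' : ℝ) (h : x ≤ x')
    (g : C → ℝ → ℚ) (hg : ∀ u y, y < 0 → g u y = 0) :
    ∑ p ∈ outN X hF s x, g p.1 (x - X.deg p.2) = ∑ p ∈ outN X hF s x', g p.1 (x - X.deg p.2) := by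
  refine Finset.sum_subset (fun p hp => ?_) (fun p hp hp' => ?_)
  · rw [mem_outN] at *
    exact ⟨hp.1, hp.2.trans h⟩
  · rw [mem_outN] at *
    refine hg _ _ ?_
    by_contra hh
    exact hp' ⟨hp.1, by linarith⟩

theorem sum_inN_ext (X : FCat C) (hF : X.FiniteType) (s : C) (x x' : ℝ) (h : x ≤ x')
    (g : C → ℝ → ℚ) (hg : ∀ u y, y < 0 → g u y = 0) :
    ∑ p ∈ inN X hF s x, g p.1 (x - X.deg p.2) = ∑ p ∈ inN X hF s x', g p.1 (x - X.deg p.2) := by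
  refine Finset.sum_subset (fun p hp => ?_) (fun p hp hp' => ?_)
  · rw [mem_inN] at *
    exact ⟨hp.1, hp.2.trans h⟩
  · rw [mem_inN] at *
    refine hg _ _ ?_
    by_contra hh
    exact hp' ⟨hp.1, by linarith⟩

theorem Qc_right (X : FCat C) (hF : X.FiniteType) (k : ℕ) : ∀ (s t : C) (x : ℝ),
    Qc X hF (k + 1) s t x = ∑ p ∈ inN X hF t x, Qc X hF k s p.1 (x - X.deg p.2) := by
  induction k with
  | zero =>
    intro s t x
    show ∑ p ∈ outN X hF s x, (if p.1 = t ∧ x - X.deg p.2 = 0 then (1:ℚ) else 0) =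
      ∑ p ∈ inN X hF t x, (if s = p.1 ∧ x - X.deg p.2 = 0 then (1:ℚ) else 0)
    rw [← Finset.sum_filter, ← Finset.sum_filter]
    simp only [Finset.sum_const, nsmul_eq_mul, mul_one]
    congr 1
    refine Finset.card_bij' (fun p hp => ⟨s, (Finset.mem_filter.1 hp).2.1 ▸ p.2⟩)
      (fun p hp => ⟨t, (Finset.mem_filter.1 hp).2.1 ▸ p.2⟩) ?_ ?_ ?_ ?_
    · rintro ⟨u, f⟩ hp
      have hp' := hp
      rw [Finset.mem_filter, mem_outN] at hp'
      obtain ⟨h1, h2, h3⟩ := hp'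
      dsimp only at h1 h2 h3
      subst h2
      rw [Finset.mem_filter, mem_inN]
      exact ⟨h1, rfl, h3⟩
    · rintro ⟨u, f⟩ hp
      have hp' := hp
      rw [Finset.mem_filter, mem_inN] at hp'
      obtain ⟨h1, h2, h3⟩ := hp'
      dsimp only at h1 h2 h3
      subst h2
      rw [Finset.mem_filter, mem_outN]
      exact ⟨h1, rfl, h3⟩
    · rintro ⟨u, f⟩ hp
      have hp' := hp
      rw [Finset.mem_filter, mem_outN] at hp'
      obtain ⟨h1, h2, h3⟩ := hp'
      dsimp only at h1 h2 h3
      subst h2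
      rfl
    · rintro ⟨u, f⟩ hp
      have hp' := hp
      rw [Finset.mem_filter, mem_inN] at hp'
      obtain ⟨h1, h2, h3⟩ := hp'
      dsimp only at h1 h2 h3
      subst h2
      rfl
  | succ k ih =>
    intro s t x
    have e1 : Qc X hF (k + 1 + 1) s t x = ∑ p ∈ outN X hF s x, ∑ r ∈ inN X hF t x,
        Qc X hF k p.1 r.1 (x - X.deg p.2 - X.deg r.2) := by
      refine Finset.sum_congr rfl fun p hp => ?_
      rw [ih]
      exact sum_inN_ext X hF t _ x (by linarith [X.deg_nonneg p.2]) (fun u y => Qc X hF k p.1 u y)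
        (fun u y hy => Qc_neg _ _ _ _ _ _ hy)
    rw [e1, Finset.sum_comm]
    refine Finset.sum_congr rfl fun r hr => ?_
    have := sum_outN_ext X hF s _ x (sub_le_self x (X.deg_nonneg r.2))
      (fun u y => Qc X hF k u r.1 y) (fun u y hy => Qc_neg _ _ _ _ _ _ hy)
    refine Eq.trans ?_ this.symm
    refine Finset.sum_congr rfl fun p _ => ?_
    rw [sub_right_comm]

theorem Qc_zero_of_le (X : FCat C) (hF : X.FiniteType) (ℓ : ℝ) (N : ℕ)
    (h : ∀ s t x, x ≤ ℓ → Qc X hF N s t x = 0) (k : ℕ) :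
    ∀ s t x, x ≤ ℓ → Qc X hF (N + k) s t x = 0 := by
  induction k with
  | zero => exact h
  | succ k ih =>
    intro s t x hx
    refine Finset.sum_eq_zero fun p _ => ih _ _ _ ?_
    linarith [X.deg_nonneg p.2]

theorem Qc_fin_out (X : FCat C) (hF : X.FiniteType) (k : ℕ) (L : ℝ) : ∀ s : C,
    {p : C × ℝ | p.2 ≤ L ∧ Qc X hF k s p.1 p.2 ≠ 0}.Finite := by
  induction k with
  | zero =>
    intro s
    refine (Set.finite_singleton (s, (0:ℝ))).subset ?_
    rintro ⟨t, x⟩ ⟨_, h⟩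
    have : s = t ∧ x = 0 := by
      by_contra h'
      exact h (if_neg h')
    rw [Set.mem_singleton_iff, this.1, this.2]
  | succ k ih =>
    intro s
    refine (((outN X hF s L).finite_toSet).biUnion (fun p _ =>
      (ih p.1).image (fun q => (q.1, q.2 + X.deg p.2)))).subset ?_
    rintro ⟨t, x⟩ ⟨hx, h⟩
    obtain ⟨p, hp, h⟩ := Finset.exists_ne_zero_of_sum_ne_zero h
    dsimp only at hx h hp
    rw [mem_outN] at hp
    simp only [Set.mem_iUnion]
    refine ⟨p, ?_, (t, x - X.deg p.2), ⟨?_, h⟩, ?_⟩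
    · rw [Finset.mem_coe, mem_outN]
      exact ⟨hp.1, hp.2.trans hx⟩
    · dsimp only
      linarith [X.deg_nonneg p.2]
    · simp

theorem Qc_fin_in (X : FCat C) (hF : X.FiniteType) (k : ℕ) (L : ℝ) : ∀ t : C,
    {p : C × ℝ | p.2 ≤ L ∧ Qc X hF k p.1 t p.2 ≠ 0}.Finite := by
  induction k with
  | zero =>
    intro s
    refine (Set.finite_singleton (s, (0:ℝ))).subset ?_
    rintro ⟨t, x⟩ ⟨_, h⟩
    have : t = s ∧ x = 0 := by
      by_contra h'
      exact h (if_neg h')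
    rw [Set.mem_singleton_iff, this.1, this.2]
  | succ k ih =>
    intro s
    refine (((inN X hF s L).finite_toSet).biUnion (fun p _ =>
      (ih p.1).image (fun q => (q.1, q.2 + X.deg p.2)))).subset ?_
    rintro ⟨t, x⟩ ⟨hx, h⟩
    rw [Qc_right] at h
    obtain ⟨p, hp, h⟩ := Finset.exists_ne_zero_of_sum_ne_zero h
    dsimp only at hx h hp
    rw [mem_inN] at hp
    simp only [Set.mem_iUnion]
    refine ⟨p, ?_, (t, x - X.deg p.2), ⟨?_, h⟩, ?_⟩
    · rw [Finset.mem_coe, mem_inN]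
      exact ⟨hp.1, hp.2.trans hx⟩
    · dsimp only
      linarith [X.deg_nonneg p.2]
    · simp

/-- all arrows -/
abbrev Arr (X : FCat C) : Type := Σ a : C, Σ b : C, X.Hom a b

/-- lists of arrows forming a non-degenerate path -/
def LPath (X : FCat C) (t : C) : C → List (Arr X) → Prop
  | s, [] => s = t
  | s, f :: l => f.1 = s ∧ ¬ X.IsIdHom f.2.2 ∧ LPath X t f.2.1 l

/-- total degree -/
def ldeg (X : FCat C) (l : List (Arr X)) : ℝ := (l.map fun f => X.deg f.2.2).sum

/-- finset of paths -/
def PF (X : FCat C) (hF : X.FiniteType) (t : C) : ℕ → C → ℝ → Finset (List (Arr X))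
  | 0 => fun s x => if s = t ∧ x = 0 then {[]} else ∅
  | k + 1 => fun s x => (outN X hF s x).biUnion fun p =>
      (PF X hF t k p.1 (x - X.deg p.2)).image (List.cons (⟨s, p.1, p.2⟩ : Arr X))

theorem card_PF (X : FCat C) (hF : X.FiniteType) (t : C) (k : ℕ) : ∀ s x,
    ((PF X hF t k s x).card : ℚ) = Qc X hF k s t x := by
  induction k with
  | zero =>
    intro s x
    show (((if s = t ∧ x = 0 then {[]} else ∅ : Finset (List (Arr X))).card : ℕ) : ℚ) =
      if s = t ∧ x = 0 then 1 else 0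
    split_ifs <;> simp
  | succ k ih =>
    intro s x
    show ((((outN X hF s x).biUnion fun p =>
      (PF X hF t k p.1 (x - X.deg p.2)).image (List.cons (⟨s, p.1, p.2⟩ : Arr X))).card : ℕ) : ℚ)
      = ∑ p ∈ outN X hF s x, Qc X hF k p.1 t (x - X.deg p.2)
    rw [Finset.card_biUnion]
    · push_cast
      refine Finset.sum_congr rfl fun p _ => ?_
      rw [← ih, Finset.card_image_of_injective _ (List.cons_injective)]
    · intro p _ p' _ hne
      rw [Function.onFun, Finset.disjoint_left]
      intro l hl hl'
      rw [Finset.mem_image] at hl hl'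
      obtain ⟨l1, _, rfl⟩ := hl
      obtain ⟨l2, _, h⟩ := hl'
      rw [List.cons.injEq] at h
      apply hne
      have := h.1
      obtain ⟨u, f⟩ := p
      obtain ⟨u', f'⟩ := p'
      have h2 := eq_of_heq (Sigma.mk.inj h.1).2
      exact h2.symm

theorem mem_PF (X : FCat C) (hF : X.FiniteType) (t : C) (k : ℕ) : ∀ s x l,
    l ∈ PF X hF t k s x ↔ LPath X t s l ∧ l.length = k ∧ ldeg X l = x := by
  induction k with
  | zero =>
    intro s x l
    show l ∈ (if s = t ∧ x = 0 then {[]} else ∅ : Finset (List (Arr X))) ↔ _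
    constructor
    · intro h
      split_ifs at h with h1
      · rw [Finset.mem_singleton] at h
        subst h
        exact ⟨h1.1, rfl, h1.2.symm⟩
      · simp at h
    · rintro ⟨h1, h2, h3⟩
      rw [List.length_eq_zero_iff] at h2
      subst h2
      rw [if_pos ⟨h1, h3.symm⟩]
      simp
  | succ k ih =>
    intro s x l
    show l ∈ ((outN X hF s x).biUnion fun p =>
      (PF X hF t k p.1 (x - X.deg p.2)).image (List.cons (⟨s, p.1, p.2⟩ : Arr X))) ↔ _
    simp only [Finset.mem_biUnion, Finset.mem_image, ih, mem_outN]
    constructor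
    · rintro ⟨p, ⟨hp, hd⟩, l, ⟨h1, h2, h3⟩, rfl⟩
      refine ⟨⟨rfl, hp, h1⟩, by simp [h2], ?_⟩
      simp only [ldeg, List.map_cons, List.sum_cons] at h3 ⊢
      linarith
    · rintro ⟨h1, h2, h3⟩
      cases l with
      | nil => simp at h2
      | cons f l =>
        obtain ⟨a, b, f⟩ := f
        obtain ⟨e, hn, hl⟩ := h1
        dsimp only at e
        subst e
        simp only [ldeg, List.map_cons, List.sum_cons] at h3
        have h0 : 0 ≤ ldeg X l := by
          refine List.sum_nonneg ?_
          intro y hy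
          rw [List.mem_map] at hy
          obtain ⟨f, _, rfl⟩ := hy
          exact X.deg_nonneg _
        rw [ldeg] at h0
        refine ⟨⟨b, f⟩, ⟨hn, by dsimp only; linarith⟩, l, ⟨hl, by simpa using h2, ?_⟩, rfl⟩
        rw [ldeg]; dsimp only; linarith

/-- list of arrows of a path -/
def NDPath.toL {X : FCat C} {a b : C} (p : NDPath X a b) : List (Arr X) :=
  List.ofFn fun i : Fin p.n => (⟨p.obj i.castSucc, p.obj i.succ, p.hom i⟩ : Arr X)

theorem toL_length {X : FCat C} {a b : C} (p : NDPath X a b) : p.toL.length = p.n := by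
  simp [NDPath.toL]

theorem toL_ldeg {X : FCat C} {a b : C} (p : NDPath X a b) : ldeg X p.toL = p.length := by
  simp [NDPath.toL, ldeg, NDPath.length, List.map_ofFn, List.sum_ofFn]

theorem lpath_ofFn (X : FCat C) (n : ℕ) : ∀ (obj : Fin (n + 1) → C)
    (hom : ∀ i : Fin n, X.Hom (obj i.castSucc) (obj i.succ))
    (_ : ∀ i : Fin n, ¬ X.IsIdHom (hom i)),
    LPath X (obj (Fin.last n)) (obj 0)
      (List.ofFn fun i : Fin n => (⟨obj i.castSucc, obj i.succ, hom i⟩ : Arr X)) := by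
  induction n with
  | zero => intro obj hom h; rfl
  | succ n ih =>
    intro obj hom h
    rw [List.ofFn_succ]
    exact ⟨rfl, h 0, ih (fun i => obj i.succ) (fun i => hom i.succ) (fun i => h i.succ)⟩

theorem toL_lpath {X : FCat C} {a b : C} (p : NDPath X a b) : LPath X b a p.toL := by
  obtain ⟨n, npos, obj, hom, src, tgt, nonid⟩ := p
  subst src tgt
  exact lpath_ofFn X n obj hom nonid

theorem toL_inj {X : FCat C} {a b : C} : Function.Injective (NDPath.toL (X := X) (a := a) (b := b)) := by
  intro p q h
  have hn : p.n = q.n := by rw [← toL_length, h, toL_length]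
  obtain ⟨n, npos, obj, hom, src, tgt, nonid⟩ := p
  obtain ⟨n', npos', obj', hom', src', tgt', nonid'⟩ := q
  dsimp only at hn
  subst hn
  have h2 := List.ofFn_injective h
  have ho : obj = obj' := by
    funext i
    refine Fin.lastCases ?_ (fun j => ?_) i
    · rw [tgt, tgt']
    · exact congrArg (fun f => (f j).1) h2
  subst ho
  have hh : hom = hom' := by
    funext i
    have := congrFun h2 i
    simpa using this
  subst hh
  rfl

theorem exists_of_lpath (X : FCat C) (t : C) (l : List (Arr X)) : ∀ s, LPath X t s l →
    ∃ (obj : Fin (l.length + 1) → C)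
      (hom : ∀ i : Fin l.length, X.Hom (obj i.castSucc) (obj i.succ)),
      (∀ i, ¬ X.IsIdHom (hom i)) ∧ obj 0 = s ∧ obj (Fin.last _) = t ∧
      List.ofFn (fun i => (⟨obj i.castSucc, obj i.succ, hom i⟩ : Arr X)) = l := by
  induction l with
  | nil =>
    intro s h
    exact ⟨fun _ => s, fun i => i.elim0, fun i => i.elim0, rfl, h, rfl⟩
  | cons f l ih =>
    rintro s ⟨h1, h2, h3⟩
    obtain ⟨obj, hom, hn, h0, hl, hL⟩ := ih _ h3
    obtain ⟨a, b, f⟩ := f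
    dsimp only at h0 h1 h2
    subst h1 h0
    refine ⟨Fin.cons a obj, Fin.cases f hom, Fin.cases h2 hn, rfl, hl, ?_⟩
    simp only [List.length_cons]
    rw [List.ofFn_succ]
    exact congrArg₂ List.cons rfl hL

theorem pathCount_eq (X : FCat C) (hF : X.FiniteType) (a b : C) (k : ℕ) (x : ℝ) :
    (pathCount X a b (k + 1) x : ℚ) = Qc X hF (k + 1) a b x := by
  rw [← card_PF, pathCount, ← Nat.card_eq_finsetCard]
  congr 1
  refine Nat.card_congr (Equiv.ofBijective (fun p => ⟨p.1.toL, by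
    rw [mem_PF, toL_length, toL_ldeg]
    exact ⟨toL_lpath _, p.2⟩⟩) ⟨?_, ?_⟩)
  · intro p q h
    exact Subtype.ext (toL_inj (congrArg Subtype.val h))
  · rintro ⟨l, hl⟩
    have hl' := hl
    rw [mem_PF] at hl'
    obtain ⟨h1, h2, h3⟩ := hl'
    obtain ⟨obj, hom, hn, h0, ht, hL⟩ := exists_of_lpath X b l a h1
    let p : NDPath X a b := ⟨l.length, by omega, obj, hom, h0, ht, hn⟩
    have hp : p.toL = l := hL
    refine ⟨⟨p, h2, ?_⟩, Subtype.ext hp⟩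
    rw [← toL_ldeg, hp, h3]

theorem exists_N (X : FCat C) (h : Tame X) (ℓ : ℝ) :
    ∃ N, ∀ k, N ≤ k → ∀ s t x, x ≤ ℓ → Qc X h.1 k s t x = 0 := by
  obtain ⟨N, hN, H⟩ := h.2 ℓ
  refine ⟨N, fun k hk => ?_⟩
  obtain ⟨j, rfl⟩ := Nat.exists_eq_add_of_le hk
  refine Qc_zero_of_le X h.1 ℓ N ?_ j
  intro s t x hx
  obtain ⟨M, rfl⟩ := Nat.exists_eq_succ_of_ne_zero hN.ne'
  rw [Nat.succ_eq_add_one, ← pathCount_eq, pathCount]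
  have : IsEmpty {p : NDPath X s t // p.n = M + 1 ∧ p.length = x} := by
    constructor
    rintro ⟨p, h1, h2⟩
    have := H s t p h1
    linarith
  simp

/-- the right-hand side -/
def RHS (X : FCat C) : C → C → ℝ → ℚ := fun a b x => matId C a b x +
      ∑ᶠ k : ℕ, ((-1 : ℚ)) ^ (k + 1) * (pathCount X a b (k + 1) x : ℚ)

theorem RHS_eq (X : FCat C) (hF : X.FiniteType) (ℓ : ℝ) (N : ℕ)
    (hN : ∀ k, N ≤ k → ∀ s t x, x ≤ ℓ → Qc X hF k s t x = 0) (s t : C) (x : ℝ) (hx : x ≤ ℓ) :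
    RHS X s t x = ∑ k ∈ Finset.range (N + 1), (-1 : ℚ) ^ k * Qc X hF k s t x := by
  rw [RHS, Finset.sum_range_succ', add_comm]
  congr 1
  · simp_rw [pathCount_eq X hF]
    refine finsum_eq_sum_of_support_subset _ ?_
    intro k hk
    rw [Finset.mem_coe, Finset.mem_range]
    by_contra h
    exact hk (by dsimp only; rw [hN (k + 1) (by omega) s t x hx, mul_zero])
  · simp [Qc]

theorem RHS_neg (X : FCat C) (h : Tame X) (s t : C) (x : ℝ) (hx : x < 0) : RHS X s t x = 0 := by
  obtain ⟨N, hN⟩ := exists_N X h 0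
  rw [RHS_eq X h.1 0 N hN s t x hx.le]
  exact Finset.sum_eq_zero fun k _ => by rw [Qc_neg _ _ _ _ _ _ hx, mul_zero]

theorem RHS_fin_out (X : FCat C) (h : Tame X) (L : ℝ) (s : C) :
    {p : C × ℝ | p.2 ≤ L ∧ RHS X s p.1 p.2 ≠ 0}.Finite := by
  obtain ⟨N, hN⟩ := exists_N X h L
  refine (((Finset.range (N + 1)).finite_toSet).biUnion
    (fun k _ => Qc_fin_out X h.1 k L s)).subset ?_
  rintro ⟨t, x⟩ ⟨hx, hh⟩
  dsimp only at hx hh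
  rw [RHS_eq X h.1 L N hN s t x hx] at hh
  obtain ⟨k, hk, hh⟩ := Finset.exists_ne_zero_of_sum_ne_zero hh
  simp only [Set.mem_iUnion]
  exact ⟨k, hk, hx, right_ne_zero_of_mul hh⟩

theorem RHS_fin_in (X : FCat C) (h : Tame X) (L : ℝ) (t : C) :
    {p : C × ℝ | p.2 ≤ L ∧ RHS X p.1 t p.2 ≠ 0}.Finite := by
  obtain ⟨N, hN⟩ := exists_N X h L
  refine (((Finset.range (N + 1)).finite_toSet).biUnion
    (fun k _ => Qc_fin_in X h.1 k L t)).subset ?_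
  rintro ⟨s, x⟩ ⟨hx, hh⟩
  dsimp only at hx hh
  rw [RHS_eq X h.1 L N hN s t x hx] at hh
  obtain ⟨k, hk, hh⟩ := Finset.exists_ne_zero_of_sum_ne_zero hh
  simp only [Set.mem_iUnion]
  exact ⟨k, hk, hx, right_ne_zero_of_mul hh⟩

theorem telesc (q : ℕ → ℚ) (N : ℕ) :
    ∑ k ∈ Finset.range N, (-1 : ℚ) ^ k * (q k + q (k + 1)) = q 0 - (-1) ^ N * q N := by
  induction N with
  | zero => simp
  | succ n ih => rw [Finset.sum_range_succ, ih]; ring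

theorem left_inv' (X : FCat C) (h : Tame X) : matConv C (zeta X) (RHS X) = matId C := by
  funext s t x
  have e := generic_conv (H := fun u => X.Hom s u) (fun f => X.deg f) x (outS X h.1 s x)
    (mem_outS X h.1 s x) (fun u y => RHS X u t y) (fun u y hy => RHS_neg X h u t y hy)
  refine Eq.trans e ?_
  obtain ⟨N, hN⟩ := exists_N X h x
  have e2 : ∀ p ∈ outS X h.1 s x, RHS X p.1 t (x - X.deg p.2) =
      ∑ k ∈ Finset.range (N + 1), (-1 : ℚ) ^ k * Qc X h.1 k p.1 t (x - X.deg p.2) := fun p _ =>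
    RHS_eq X h.1 x N hN _ _ _ (sub_le_self _ (X.deg_nonneg _))
  rw [Finset.sum_congr rfl e2, Finset.sum_comm]
  have e3 : ∀ k, ∑ p ∈ outS X h.1 s x, (-1 : ℚ) ^ k * Qc X h.1 k p.1 t (x - X.deg p.2) =
      (-1 : ℚ) ^ k * (Qc X h.1 k s t x + Qc X h.1 (k + 1) s t x) := by
    intro k
    rw [← Finset.mul_sum]
    congr 1
    exact sum_outS X h.1 s x (fun u y => Qc X h.1 k u t y) (fun u y hy => Qc_neg _ _ _ _ _ _ hy)
  simp_rw [e3]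
  rw [telesc (fun k => Qc X h.1 k s t x)]
  rw [hN (N + 1) (by omega) s t x le_rfl]
  simp [Qc]

theorem right_inv' (X : FCat C) (h : Tame X) : matConv C (RHS X) (zeta X) = matId C := by
  funext s t x
  have e := generic_conv (H := fun u => X.Hom u t) (fun f => X.deg f) x (inS X h.1 t x)
    (mem_inS X h.1 t x) (fun u y => RHS X s u y) (fun u y hy => RHS_neg X h s u y hy)
  have e0 : matConv C (RHS X) (zeta X) s t x = ∑ᶠ u : C, ∑ᶠ y : ℝ,
      (Nat.card {f : X.Hom u t // X.deg f = y} : ℚ) * RHS X s u (x - y) := by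
    refine finsum_congr fun u => ?_
    show ∑ᶠ y : ℝ, RHS X s u y * zeta X u t (x - y) = _
    rw [← finsum_comp_equiv (Equiv.subLeft x)]
    refine finsum_congr fun y => ?_
    simp [zeta, mul_comm]
  refine e0.trans (Eq.trans e ?_)
  obtain ⟨N, hN⟩ := exists_N X h x
  have e2 : ∀ p ∈ inS X h.1 t x, RHS X s p.1 (x - X.deg p.2) =
      ∑ k ∈ Finset.range (N + 1), (-1 : ℚ) ^ k * Qc X h.1 k s p.1 (x - X.deg p.2) := fun p _ =>
    RHS_eq X h.1 x N hN _ _ _ (sub_le_self _ (X.deg_nonneg _))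
  rw [Finset.sum_congr rfl e2, Finset.sum_comm]
  have e3 : ∀ k, ∑ p ∈ inS X h.1 t x, (-1 : ℚ) ^ k * Qc X h.1 k s p.1 (x - X.deg p.2) =
      (-1 : ℚ) ^ k * (Qc X h.1 k s t x + Qc X h.1 (k + 1) s t x) := by
    intro k
    rw [← Finset.mul_sum, Qc_right]
    congr 1
    exact sum_inS X h.1 t x (fun u y => Qc X h.1 k s u y) (fun u y hy => Qc_neg _ _ _ _ _ _ hy)
  simp_rw [e3]
  rw [telesc (fun k => Qc X h.1 k s t x)]
  rw [hN (N + 1) (by omega) s t x le_rfl]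
  simp [Qc]

/-- Let `C` be a tame `CFset`-category.  Then
`ζ_C⁻¹(a,b) = δ(a,b) + ∑_{k≥1} (-1)^k ∑_{f₁∼⋯∼f_k nondegenerate, a → b} q^{∑ deg f_i}`:
the outer sum converges in `A` (for each coefficient `x` only finitely many `k`
contribute), and the right-hand side is a two-sided inverse of `ζ_C` in `M_C(A)`. -/
theorem stmt6 (X : FCat C) (htame : Tame X) :
    -- convergence of the outer sum in A
    (∀ (a b : C) (x : ℝ), {k : ℕ | pathCount X a b k x ≠ 0}.Finite) ∧
    -- the right-hand side is an element of M_C(A), entrywise in A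
    (∀ a b : C, IsNov (fun x => matId C a b x +
      ∑ᶠ k : ℕ, ((-1 : ℚ)) ^ (k + 1) * (pathCount X a b (k + 1) x : ℚ))) ∧
    MSmat C (fun a b x => matId C a b x +
      ∑ᶠ k : ℕ, ((-1 : ℚ)) ^ (k + 1) * (pathCount X a b (k + 1) x : ℚ)) ∧
    -- and it is a two-sided inverse of ζ_C
    matConv C (zeta X) (fun a b x => matId C a b x +
      ∑ᶠ k : ℕ, ((-1 : ℚ)) ^ (k + 1) * (pathCount X a b (k + 1) x : ℚ)) = matId C ∧
    matConv C (fun a b x => matId C a b x +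
      ∑ᶠ k : ℕ, ((-1 : ℚ)) ^ (k + 1) * (pathCount X a b (k + 1) x : ℚ)) (zeta X) = matId C := by
  refine ⟨?_, ?_, ?_, left_inv' X htame, right_inv' X htame⟩
  · intro a b x
    obtain ⟨N, hN⟩ := exists_N X htame x
    refine (Finset.range (N + 1)).finite_toSet.subset ?_
    intro k hk
    rw [Finset.mem_coe, Finset.mem_range]
    by_contra h
    obtain ⟨j, rfl⟩ := Nat.exists_eq_succ_of_ne_zero (show k ≠ 0 by omega)
    have := pathCount_eq X htame.1 a b j x
    rw [hN (j + 1) (by omega) a b x le_rfl] at this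
    exact hk (by exact_mod_cast this)
  · intro a b
    refine ⟨fun L => ?_, fun x hx => RHS_neg X htame a b x hx⟩
    refine ((RHS_fin_out X htame L a).image Prod.snd).subset ?_
    rintro x ⟨hx, h⟩
    exact ⟨(b, x), ⟨hx, h⟩, rfl⟩
  · intro L s
    constructor
    · refine ((RHS_fin_out X htame L s).image Prod.fst).subset ?_
      rintro t ⟨x, hx, h⟩
      exact ⟨(t, x), ⟨hx.le, h⟩, rfl⟩
    · refine ((RHS_fin_in X htame L s).image Prod.fst).subset ?_
      rintro t ⟨x, hx, h⟩
      exact ⟨(t, x), ⟨hx.le, h⟩, rfl⟩
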